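/- arXiv:1304.5521 — 5 statements merged into one kernel-verified Lean document; each statement's English description precedes it below -/
import Mathlib

section
/- Let a, b be integers and c a positive integer with gcd(a, c) = 1, and define the generalized quadratic Gauß sum G(a, b, c) = ∑_{l=0}^{c-1} exp(2πi(a l² + b l)/c). Then the classical quadratic Gauß sum G(a, 0, c) = ∑_{l=0}^{c-1} exp(2πi a l²/c) satisfies: G(a, 0, c) = (c|a)·(1 + i^a)·√c if c ≡ 0 (mod 4) (here a is necessarily odd and (c|a) is the Jacobi symbol); G(a, 0, c) = (a|c)·√c if c ≡ 1 (mod 4); G(a, 0, c) = 0 if c ≡ 2 (mod 4); and G(a, 0, c) = (a|c)·i·√c if c ≡ 3 (mod 4). -/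
open Finset Real

/-- The generalized quadratic Gauß sum `G(a, b, c) = ∑_{l=0}^{c-1} exp(2πi(a l² + b l)/c)`. -/
noncomputable def gaussSumG (a b : ℤ) (c : ℕ) : ℂ :=
  ∑ l ∈ Finset.range c, Complex.exp (2 * Real.pi * Complex.I * ((a : ℂ) * l ^ 2 + (b : ℂ) * l) / c)

open ZMod (stdAddChar)

lemma sum_range_natCast_zmod {M : Type*} [AddCommMonoid M] (c : ℕ) [NeZero c] (f : ZMod c → M) :
    ∑ l ∈ range c, f l = ∑ x : ZMod c, f x := by
  refine sum_bij' (fun l _ => (l : ZMod c)) (fun x _ => x.val) ?_ ?_ ?_ ?_ ?_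
  · simp
  · intro x _
    exact mem_range.2 x.val_lt
  · intro l hl
    exact ZMod.val_cast_of_lt (mem_range.1 hl)
  · intro x _
    exact ZMod.natCast_zmod_val x
  · simp

lemma gaussSumG_zero_eq_sum_zmod (a : ℤ) (c : ℕ) [NeZero c] :
    gaussSumG a 0 c = ∑ x : ZMod c, stdAddChar ((a : ZMod c) * x ^ 2) := by
  rw [← sum_range_natCast_zmod, gaussSumG]
  refine sum_congr rfl fun l _ => ?_
  have := ZMod.stdAddChar_coe (N := c) (a * (l : ℤ) ^ 2)
  push_cast at this
  rw [this]
  congr 1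
  push_cast
  ring

/-- Inside a character modulo `k * n`, the factor `k` can be cancelled. -/
lemma stdAddChar_mul_left (k n : ℕ) [NeZero k] [NeZero n] (j : ℤ) :
    stdAddChar (((k * j : ℤ)) : ZMod (k * n)) = stdAddChar (j : ZMod n) := by
  have : NeZero (k * n) := ⟨mul_ne_zero (NeZero.ne k) (NeZero.ne n)⟩
  rw [ZMod.stdAddChar_coe, ZMod.stdAddChar_coe]
  have hk : (k : ℂ) ≠ 0 := Nat.cast_ne_zero.2 (NeZero.ne k)
  have hn : (n : ℂ) ≠ 0 := Nat.cast_ne_zero.2 (NeZero.ne n)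
  congr 1
  push_cast
  field_simp

lemma stdAddChar_mul_right (n k : ℕ) [NeZero k] [NeZero n] (j : ℤ) :
    stdAddChar (((k * j : ℤ)) : ZMod (n * k)) = stdAddChar (j : ZMod n) := by
  have : NeZero (n * k) := ⟨mul_ne_zero (NeZero.ne n) (NeZero.ne k)⟩
  rw [ZMod.stdAddChar_coe, ZMod.stdAddChar_coe]
  have hk : (k : ℂ) ≠ 0 := Nat.cast_ne_zero.2 (NeZero.ne k)
  have hn : (n : ℂ) ≠ 0 := Nat.cast_ne_zero.2 (NeZero.ne n)
  congr 1
  push_cast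
  field_simp

/-- The parametrization of residues modulo `m * n` behind the multiplicativity of Gauss sums. -/
lemma bijective_crt_param (m n : ℕ) [NeZero m] [NeZero n] (hmn : m.Coprime n) :
    Function.Bijective (fun p : ZMod m × ZMod n =>
      ((n * p.1.val + m * p.2.val : ℕ) : ZMod (m * n))) := by
  have : NeZero (m * n) := ⟨mul_ne_zero (NeZero.ne m) (NeZero.ne n)⟩
  rw [Fintype.bijective_iff_injective_and_card]
  refine ⟨fun p q hpq => ?_, by simp [ZMod.card]⟩
  have h1 := congrArg (ZMod.castHom (dvd_mul_right m n) (ZMod m)) hpq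
  have h2 := congrArg (ZMod.castHom (dvd_mul_left n m) (ZMod n)) hpq
  simp only [map_natCast] at h1 h2
  simp at h1 h2
  refine Prod.ext ?_ ?_
  · exact ((ZMod.isUnit_iff_coprime n m).2 hmn.symm).mul_left_cancel h1
  · exact ((ZMod.isUnit_iff_coprime m n).2 hmn).mul_left_cancel h2

lemma gaussSumG_mul (a : ℤ) (m n : ℕ) [NeZero m] [NeZero n] (hmn : m.Coprime n) :
    gaussSumG a 0 (m * n) = gaussSumG (a * n) 0 m * gaussSumG (a * m) 0 n := by
  have : NeZero (m * n) := ⟨mul_ne_zero (NeZero.ne m) (NeZero.ne n)⟩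
  simp only [gaussSumG_zero_eq_sum_zmod]
  rw [sum_mul_sum, ← Fintype.sum_prod_type', ← (bijective_crt_param m n hmn).sum_comp]
  refine sum_congr rfl fun p _ => ?_
  have e1 : ((a * n : ℤ) : ZMod m) * p.1 ^ 2 = ((a * n * p.1.val ^ 2 : ℤ) : ZMod m) := by simp
  have e2 : ((a * m : ℤ) : ZMod n) * p.2 ^ 2 = ((a * m * p.2.val ^ 2 : ℤ) : ZMod n) := by simp
  rw [e1, e2, ← stdAddChar_mul_right m n, ← stdAddChar_mul_left m n, ← AddChar.map_add_eq_mul]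
  congr 1
  have h0 : (m : ZMod (m * n)) * n = 0 := by
    rw [← Nat.cast_mul, ZMod.natCast_self]
  push_cast
  linear_combination (2 * (a : ZMod (m * n)) * (p.1.val : ZMod (m * n)) * p.2.val) * h0

lemma gaussSumG_prime (p : ℕ) [Fact p.Prime] (hp : p ≠ 2) (a : ℤ) (ha : (a : ZMod p) ≠ 0) :
    gaussSumG a 0 p = legendreSym p a * gaussSumG 1 0 p := by
  have key : ∀ b : ℤ, (b : ZMod p) ≠ 0 → gaussSumG b 0 p =
      ∑ y : ZMod p, (quadraticChar (ZMod p) y : ℂ) * stdAddChar ((b : ZMod p) * y) := by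
    intro b hb
    have h0 : ∑ y : ZMod p, stdAddChar ((b : ZMod p) * y) = 0 := by
      have := AddChar.sum_mulShift (b : ZMod p) (ZMod.isPrimitive_stdAddChar p)
      rw [if_neg hb] at this
      simpa [mul_comm] using this
    rw [gaussSumG_zero_eq_sum_zmod, ← sum_fiberwise (s := univ) (g := fun x : ZMod p => x ^ 2),
      ← add_zero (∑ y : ZMod p, (quadraticChar (ZMod p) y : ℂ) * _), ← h0, ← sum_add_distrib]
    refine sum_congr rfl fun y _ => ?_
    have hc := quadraticChar_card_sqrts (F := ZMod p) (by rwa [ZMod.ringChar_zmod_n]) y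
    rw [sum_congr rfl (g := fun _ => stdAddChar ((b : ZMod p) * y))
      (fun x hx => by rw [(mem_filter.1 hx).2]), sum_const, nsmul_eq_mul]
    have : ((#{x : ZMod p | x ^ 2 = y} : ℕ) : ℂ) = quadraticChar (ZMod p) y + 1 := by
      rw [Set.toFinset_ofPred] at hc
      exact_mod_cast hc
    rw [this]
    ring
  rw [key a ha, key 1 (by simp), mul_sum]
  symm
  refine Fintype.sum_bijective (fun y => (a : ZMod p)⁻¹ * y)
    (mulLeft_bijective₀ _ (inv_ne_zero ha)) _ _ fun y => ?_
  have hs : (quadraticChar (ZMod p) (a : ZMod p) : ℂ) * quadraticChar (ZMod p) (a : ZMod p) = 1 := by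
    exact_mod_cast (sq _).symm.trans (quadraticChar_sq_one ha)
  have hy : quadraticChar (ZMod p) y =
      quadraticChar (ZMod p) (a : ZMod p) * quadraticChar (ZMod p) ((a : ZMod p)⁻¹ * y) := by
    rw [← map_mul, mul_inv_cancel_left₀ ha]
  rw [mul_inv_cancel_left₀ ha, legendreSym, hy]
  push_cast
  rw [one_mul, ← mul_assoc, ← mul_assoc, hs, one_mul]

lemma sum_range_mul_eq {M : Type*} [AddCommMonoid M] (f : ℕ → M) (m n : ℕ) :
    ∑ l ∈ range (m * n), f l = ∑ u ∈ range m, ∑ v ∈ range n, f (u + m * v) := by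
  induction n with
  | zero => simp
  | succ n ih =>
    simp only [Nat.mul_succ, sum_range_add, sum_range_succ, sum_add_distrib, ih]
    simp [add_comm]

lemma gaussSumG_zero_eq_sum_range (a : ℤ) (c : ℕ) [NeZero c] :
    gaussSumG a 0 c = ∑ l ∈ range c, stdAddChar ((a * (l : ℤ) ^ 2 : ℤ) : ZMod c) := by
  rw [gaussSumG_zero_eq_sum_zmod, ← sum_range_natCast_zmod]
  simp

lemma gaussSumG_mul_prime_sq (p : ℕ) [Fact p.Prime] (hp : p ≠ 2) (a : ℤ) (ha : (a : ZMod p) ≠ 0)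
    (m : ℕ) [NeZero m] : gaussSumG a 0 (m * p * p) = p * gaussSumG a 0 m := by
  have hp2 : (2 : ZMod p) ≠ 0 := by
    have := Ring.two_ne_zero (R := ZMod p) (by rwa [ZMod.ringChar_zmod_n])
    exact this
  have : NeZero p := ⟨(Fact.out : p.Prime).ne_zero⟩
  have : NeZero (m * p) := ⟨mul_ne_zero (NeZero.ne m) (NeZero.ne p)⟩
  have : NeZero (m * p * p) := ⟨mul_ne_zero (NeZero.ne (m * p)) (NeZero.ne p)⟩
  have split (u v : ℕ) :
      stdAddChar ((a * ((u + m * p * v : ℕ) : ℤ) ^ 2 : ℤ) : ZMod (m * p * p)) =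
        stdAddChar ((a * (u : ℤ) ^ 2 : ℤ) : ZMod (m * p * p)) *
          stdAddChar ((v : ZMod p) * (2 * (a : ZMod p) * (u : ZMod p))) := by
    have e : (v : ZMod p) * (2 * (a : ZMod p) * (u : ZMod p)) = ((v * (2 * a * u) : ℤ) : ZMod p) := by
      simp
    rw [e, ← stdAddChar_mul_left (m * p) p, ← AddChar.map_add_eq_mul]
    congr 1
    have h0 : (m : ZMod (m * p * p)) * p * p = 0 := by
      rw [← Nat.cast_mul, ← Nat.cast_mul, ZMod.natCast_self]
    push_cast
    linear_combination ((a : ZMod (m * p * p)) * m * v ^ 2) * h0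
  have inner (u : ℕ) :
      ∑ v ∈ range p, stdAddChar ((v : ZMod p) * (2 * (a : ZMod p) * (u : ZMod p))) =
      if (u : ZMod p) = 0 then (p : ℂ) else 0 := by
    rw [sum_range_natCast_zmod p fun v => stdAddChar (v * (2 * a * u : ZMod p)),
      AddChar.sum_mulShift _ (ZMod.isPrimitive_stdAddChar p)]
    simp [hp2, ha, ZMod.card]
  rw [gaussSumG_zero_eq_sum_range, sum_range_mul_eq]
  simp_rw [split, ← mul_sum, inner]
  rw [show range (m * p) = range (p * m) by rw [mul_comm], sum_range_mul_eq, sum_eq_single 0,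
    gaussSumG_zero_eq_sum_range, mul_sum]
  · refine sum_congr rfl fun s _ => ?_
    rw [← stdAddChar_mul_right m p, ← stdAddChar_mul_right (m * p) p]
    simp
    ring_nf
  · intro r hr hr0
    refine sum_eq_zero fun s _ => ?_
    rw [if_neg, mul_zero]
    simp only [Nat.cast_add, Nat.cast_mul, CharP.cast_eq_zero, zero_mul, add_zero]
    rw [ZMod.natCast_eq_zero_iff]
    exact Nat.not_dvd_of_pos_of_lt (Nat.pos_of_ne_zero hr0) (mem_range.1 hr)
  · simp [NeZero.ne p]

lemma gaussSumG_one (a : ℤ) : gaussSumG a 0 1 = 1 := by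
  simp [gaussSumG]

lemma gaussSumG_prime_pow (p : ℕ) [Fact p.Prime] (hp : p ≠ 2) (a : ℤ) (ha : (a : ZMod p) ≠ 0)
    (k : ℕ) : gaussSumG a 0 (p ^ k) = (jacobiSym a (p ^ k) : ℂ) * gaussSumG 1 0 (p ^ k) := by
  have hJ : (jacobiSym a p : ℂ) ^ 2 = 1 := by
    rw [← jacobiSym.legendreSym.to_jacobiSym]
    exact_mod_cast legendreSym.sq_one p ha
  induction k using Nat.twoStepInduction with
  | zero => simp [gaussSumG_one]
  | one =>
    rw [pow_one, gaussSumG_prime p hp a ha, jacobiSym.legendreSym.to_jacobiSym]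
  | more k ih _ =>
    have : NeZero (p ^ k) := ⟨pow_ne_zero _ (Fact.out : p.Prime).ne_zero⟩
    have e : p ^ (k + 2) = p ^ k * p * p := by ring
    rw [e, gaussSumG_mul_prime_sq p hp a ha, gaussSumG_mul_prime_sq p hp 1 (by simp), ih, ← e,
      jacobiSym.pow_right, jacobiSym.pow_right]
    push_cast
    linear_combination (-(jacobiSym a p : ℂ) ^ k * p * gaussSumG 1 0 (p ^ k)) * hJ

lemma gaussSumG_odd (c : ℕ) (hc : Odd c) (a : ℤ) (h : Int.gcd a c = 1) :
    gaussSumG a 0 c = (jacobiSym a c : ℂ) * gaussSumG 1 0 c := by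
  induction c using Nat.recOnPrimeCoprime generalizing a with
  | zero => simp at hc
  | prime_pow p n hp =>
    rcases n.eq_zero_or_pos with rfl | hn
    · simp [gaussSumG_one]
    have := Fact.mk hp
    refine gaussSumG_prime_pow p ?_ a ?_ n
    · rintro rfl
      exact Nat.not_odd_iff_even.2 ((even_two).pow_of_ne_zero hn.ne') hc
    · rw [Ne, ZMod.intCast_zmod_eq_zero_iff_dvd]
      intro hd
      have : (p : ℤ) ∣ Int.gcd a (p ^ n : ℕ) :=
        Int.dvd_coe_gcd hd (by exact_mod_cast dvd_pow_self p hn.ne')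
      rw [h] at this
      exact hp.one_lt.ne' (by exact_mod_cast Int.eq_one_of_dvd_one (by positivity) this)
  | coprime m n hm hn hmn ihm ihn =>
    have : NeZero m := ⟨by omega⟩
    have : NeZero n := ⟨by omega⟩
    have hn' := Nat.Odd.of_mul_right hc
    have hm' := Nat.Odd.of_mul_left hc
    have hnm : Int.gcd n m = 1 := by simpa using hmn.symm
    have hmn2 : Int.gcd m n = 1 := by simpa using hmn
    rw [← Int.isCoprime_iff_gcd_eq_one] at h hnm hmn2
    push_cast at h
    rw [gaussSumG_mul a m n hmn, gaussSumG_mul 1 m n hmn, one_mul, one_mul,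
      ihm hm' (a * n) (Int.isCoprime_iff_gcd_eq_one.1 (h.of_mul_right_left.mul_left hnm)),
      ihn hn' (a * m) (Int.isCoprime_iff_gcd_eq_one.1 (h.of_mul_right_right.mul_left hmn2)),
      ihm hm' n (Int.isCoprime_iff_gcd_eq_one.1 hnm),
      ihn hn' m (Int.isCoprime_iff_gcd_eq_one.1 hmn2),
      jacobiSym.mul_left, jacobiSym.mul_left, jacobiSym.mul_right]
    push_cast
    ring

open Filter Topology Complex in
lemma tendsto_jacobiTheta₂_ofReal {ι : Type*} {L : Filter ι} (x : ℝ) (τ : ι → ℂ)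
    (hτ : Tendsto (fun i => (τ i).im) L atTop) :
    Tendsto (fun i => jacobiTheta₂ x (τ i)) L (𝓝 1) := by
  have hs : Summable (fun n : ℤ => Real.exp (-π * n ^ 2)) := by
    simpa using summable_pow_mul_jacobiTheta₂_term_bound 0 one_pos 0
  have h1 : ∑' n : ℤ, (if n = 0 then (1 : ℂ) else 0) = 1 := tsum_ite_eq 0 _
  rw [← h1]
  refine tendsto_tsum_of_dominated_convergence hs (fun n => ?_) ?_
  · split_ifs with hn
    · subst hn
      simp [jacobiTheta₂_term, tendsto_const_nhds]
    · rw [tendsto_zero_iff_norm_tendsto_zero]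
      simp_rw [norm_jacobiTheta₂_term, ofReal_im, mul_zero, sub_zero]
      have hn' : 0 < π * (n : ℝ) ^ 2 := by positivity
      refine Real.tendsto_exp_atBot.comp ?_
      simpa using (hτ.const_mul_atTop hn')
  · filter_upwards [hτ.eventually_ge_atTop 1] with i hi n
    rw [norm_jacobiTheta₂_term, ofReal_im, mul_zero, sub_zero, Real.exp_le_exp]
    nlinarith [mul_nonneg pi_pos.le (sq_nonneg (n : ℝ))]

open Complex in
lemma cpow_half_pos_mul {r : ℝ} (hr : 0 < r) (w : ℂ) :
    ((r : ℂ) * w) ^ (1 / 2 : ℂ) = (√r : ℂ) * w ^ (1 / 2 : ℂ) := by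
  rcases eq_or_ne w 0 with rfl | hw
  · simp
  rw [Complex.cpow_def_of_ne_zero (by simp [hr.ne', hw]), Complex.cpow_def_of_ne_zero hw,
    Complex.log_ofReal_mul hr hw, Real.sqrt_eq_rpow, Complex.ofReal_cpow hr.le,
    Complex.cpow_def_of_ne_zero (by simp [hr.ne']), ← Complex.exp_add, Complex.ofReal_log hr.le]
  congr 1
  push_cast
  ring

/-- Poisson summation along a residue class. -/
lemma tsum_exp_residue {w : ℂ} (hw : 0 < w.re) (N : ℕ) [NeZero N] (r : ℕ) :
    ∑' n : ℤ, Complex.exp (-π * (n * N + r : ℂ) ^ 2 / w) =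
      w ^ (1 / 2 : ℂ) / N * jacobiTheta₂ ((r / N : ℝ) : ℂ) (Complex.I * (w / N ^ 2)) := by
  have hN : (N : ℂ) ≠ 0 := Nat.cast_ne_zero.2 (NeZero.ne N)
  have hw0 : w ≠ 0 := by rintro rfl; simp at hw
  have hNr : (0 : ℝ) < (N : ℝ) ^ 2 := by have := NeZero.pos N; positivity
  have hNw : w = ((N ^ 2 : ℝ) : ℂ) * (w / N ^ 2) := by push_cast; field_simp
  have hs : w ^ (1 / 2 : ℂ) = N * (w / N ^ 2) ^ (1 / 2 : ℂ) := by
    conv_lhs => rw [hNw, cpow_half_pos_mul hNr, Real.sqrt_sq (Nat.cast_nonneg N)]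
    simp
  have hv0 : w / (N : ℂ) ^ 2 ≠ 0 := div_ne_zero hw0 (pow_ne_zero _ hN)
  rw [jacobiTheta₂_functional_equation, hs]
  have e : -Complex.I * (Complex.I * (w / N ^ 2)) = w / N ^ 2 := by
    linear_combination (-(w / N ^ 2)) * Complex.I_sq
  have hne : (w / (N : ℂ) ^ 2) ^ (1 / 2 : ℂ) ≠ 0 := by
    rw [Complex.cpow_ne_zero_iff]; exact Or.inl hv0
  rw [e, mul_div_cancel_left₀ _ hN, ← mul_assoc, ← mul_assoc, mul_one_div_cancel hne, one_mul,
    jacobiTheta₂, ← tsum_mul_left, ← (Equiv.neg ℤ).tsum_eq]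
  refine tsum_congr fun n => ?_
  rw [jacobiTheta₂_term, ← Complex.exp_add]
  congr 1
  simp only [Equiv.neg_apply]
  push_cast
  have hI := Complex.I_ne_zero
  field_simp
  ring

open Filter Topology in
/-- A weighted theta series with periodic weights behaves near the cusp like the mean weight. -/
lemma tendsto_theta_mean {ι : Type*} {L : Filter ι} (w : ι → ℂ)
    (hw : Tendsto (fun i => (w i).re) L atTop) (N : ℕ) [NeZero N] (f : ℤ → ℂ)
    (hf1 : ∀ n, ‖f n‖ ≤ 1) (hf : ∀ n (r : ℕ), f (n * N + r) = f r) :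
    Tendsto (fun i => (∑' n : ℤ, f n * Complex.exp (-π * n ^ 2 / w i)) / (w i) ^ (1 / 2 : ℂ)) L
      (𝓝 ((∑ r ∈ range N, f r) / N)) := by
  have hNr : (0 : ℝ) < (N : ℝ) ^ 2 := by have := NeZero.pos N; positivity
  have key : ∀ᶠ i in L, (∑' n : ℤ, f n * Complex.exp (-π * n ^ 2 / w i)) / (w i) ^ (1 / 2 : ℂ) =
      ∑ r ∈ range N, f r / N *
        jacobiTheta₂ ((r / N : ℝ) : ℂ) (Complex.I * (w i / N ^ 2)) := by
    filter_upwards [hw.eventually_gt_atTop 0] with i hi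
    have hw0 : w i ≠ 0 := by intro h; simp [h] at hi
    have hne : (w i) ^ (1 / 2 : ℂ) ≠ 0 := by
      rw [Complex.cpow_ne_zero_iff]; exact Or.inl hw0
    have hsum : Summable fun n : ℤ => f n * Complex.exp (-π * n ^ 2 / w i) := by
      have him : 0 < (Complex.I / w i).im := by
        rw [div_eq_mul_inv, Complex.I_mul_im, Complex.inv_re]
        exact div_pos hi (Complex.normSq_pos.2 hw0)
      refine Summable.of_norm_bounded ((summable_jacobiTheta₂_term_iff 0 _).2 him).norm fun n => ?_
      have e : Complex.exp (-π * n ^ 2 / w i) = jacobiTheta₂_term n 0 (Complex.I / w i) := by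
        rw [jacobiTheta₂_term]
        congr 1
        linear_combination (-(π : ℂ) * n ^ 2 / w i) * Complex.I_sq
      rw [norm_mul, e]
      exact mul_le_of_le_one_left (norm_nonneg _) (hf1 n)
    rw [← (Int.divModEquiv N).symm.tsum_eq, ← (Equiv.prodComm _ _).tsum_eq, Summable.tsum_prod,
      tsum_fintype, Finset.sum_div, Finset.sum_range]
    · refine sum_congr rfl fun r _ => ?_
      simp only [Equiv.prodComm_apply, Prod.swap_prod_mk, Int.divModEquiv_symm_apply, hf,
        tsum_mul_left]
      have := tsum_exp_residue hi N r
      push_cast at this ⊢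
      rw [this]
      field_simp
    · exact (Equiv.summable_iff _).2 ((Equiv.summable_iff _).2 hsum)
  refine Tendsto.congr' (EventuallyEq.symm key) ?_
  rw [Finset.sum_div]
  refine tendsto_finsetSum _ fun r _ => ?_
  have := (tendsto_jacobiTheta₂_ofReal (L := L) (r / N : ℝ)
    (fun i => Complex.I * (w i / N ^ 2)) ?_).const_mul (f r / N)
  · simpa using this
  · have h2 := hw.atTop_div_const hNr
    refine h2.congr fun i => ?_
    have : (N : ℂ) ^ 2 = ((N ^ 2 : ℝ) : ℂ) := by push_cast; rfl
    rw [this, Complex.I_mul_im, Complex.div_ofReal_re]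

open Filter Topology in
/-- The closed form of `G(1, 0, c)`, from the modularity of the theta function at the cusp `2 / c`. -/
lemma gaussSumG_one_left (c : ℕ) [NeZero c] :
    gaussSumG 1 0 c = √c * ((1 + Complex.I) / 2) * (1 + (-Complex.I) ^ c) := by
  have hc : (c : ℂ) ≠ 0 := Nat.cast_ne_zero.2 (NeZero.ne c)
  have hcr : (0 : ℝ) < c := Nat.cast_pos.2 (NeZero.pos c)
  have hI := Complex.I_sq
  have norm_one (x : ℝ) : ‖Complex.exp (x * Complex.I)‖ ≤ 1 :=
    (Complex.norm_exp_ofReal_mul_I x).le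
  set w : ℝ → ℂ := fun t => 4 * t / c ^ 2 + 2 * Complex.I / c with hw
  have hwre (t : ℝ) : (w t).re = 4 * t / c ^ 2 := by
    have : w t = ((4 * t / c ^ 2 : ℝ) : ℂ) + ((2 / c : ℝ) : ℂ) * Complex.I := by
      simp only [hw]; push_cast; ring
    rw [this, Complex.add_re, Complex.ofReal_re, Complex.re_ofReal_mul, Complex.I_re, mul_zero,
      add_zero]
  have lim1 := tendsto_theta_mean (fun t : ℝ => (t : ℂ)) (L := atTop)
    (by simp only [Complex.ofReal_re]; exact tendsto_id) c
    (fun n => Complex.exp ((2 * π * n ^ 2 / c : ℝ) * Complex.I)) (fun n => norm_one _) (fun n r => by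
      rw [Complex.exp_eq_exp_iff_exists_int]
      refine ⟨n ^ 2 * c + 2 * n * r, ?_⟩
      push_cast
      field_simp
      ring)
  have lim2 := tendsto_theta_mean w (L := atTop)
    (by
      simp_rw [hwre]
      exact (tendsto_id.const_mul_atTop (by norm_num : (0 : ℝ) < 4)).atTop_div_const (by positivity))
    2 (fun n => Complex.exp ((-π * c * n ^ 2 / 2 : ℝ) * Complex.I)) (fun n => norm_one _)
    (fun n r => by
      rw [Complex.exp_eq_exp_iff_exists_int]
      refine ⟨-(c * n ^ 2 + c * n * r), ?_⟩
      push_cast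
      ring)
  have mean1 : ∑ r ∈ range c, Complex.exp ((2 * π * ((r : ℤ) : ℝ) ^ 2 / c : ℝ) * Complex.I) =
      gaussSumG 1 0 c := by
    rw [gaussSumG]
    refine sum_congr rfl fun r _ => ?_
    congr 1
    push_cast
    ring
  have mean2 : ∑ r ∈ range 2, Complex.exp ((-π * c * ((r : ℤ) : ℝ) ^ 2 / 2 : ℝ) * Complex.I) =
      1 + (-Complex.I) ^ c := by
    have : -Complex.I = Complex.exp (-π / 2 * Complex.I) := by
      rw [Complex.exp_neg_pi_div_two_mul_I]
    rw [this, ← Complex.exp_nat_mul]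
    simp only [sum_range_succ, sum_range_zero]
    simp
    ring_nf
  rw [mean1] at lim1
  rw [mean2] at lim2
  have lim3 : Tendsto (fun t : ℝ => w t / t) atTop (𝓝 (4 / c ^ 2)) := by
    have h0 : Tendsto (fun t : ℝ => ((t⁻¹ : ℝ) : ℂ)) atTop (𝓝 0) := by
      exact_mod_cast (Complex.continuous_ofReal.tendsto 0).comp tendsto_inv_atTop_zero
    have := (h0.const_mul (2 * Complex.I / c)).const_add (4 / (c : ℂ) ^ 2)
    rw [mul_zero, add_zero] at this
    refine this.congr' ?_
    filter_upwards [eventually_gt_atTop 0] with t ht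
    have : (t : ℂ) ≠ 0 := by exact_mod_cast ht.ne'
    simp only [hw]
    push_cast
    field_simp
  have lim4 : Tendsto (fun t : ℝ => -Complex.I * (2 / c + Complex.I / t)) atTop
      (𝓝 (-Complex.I * (2 / c))) := by
    have h0 : Tendsto (fun t : ℝ => ((t⁻¹ : ℝ) : ℂ)) atTop (𝓝 0) := by
      exact_mod_cast (Complex.continuous_ofReal.tendsto 0).comp tendsto_inv_atTop_zero
    have := ((h0.const_mul Complex.I).const_add (2 / (c : ℂ))).const_mul (-Complex.I)
    rw [mul_zero, add_zero] at this
    refine this.congr fun t => ?_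
    push_cast
    ring
  have value3 : (4 / (c : ℂ) ^ 2) ^ (1 / 2 : ℂ) = 2 / c := by
    have := cpow_half_pos_mul (r := (2 / c) ^ 2) (by positivity) 1
    rw [Real.sqrt_sq (by positivity), Complex.one_cpow, mul_one, mul_one] at this
    push_cast at this
    rw [← this]
    congr 1
    ring
  have value4 : (-Complex.I * (2 / (c : ℂ))) ^ (1 / 2 : ℂ) = (1 - Complex.I) / √c := by
    have h1 := cpow_half_pos_mul (r := 2 / c) (by positivity) (-Complex.I)
    have h2 : (-Complex.I) ^ (1 / 2 : ℂ) = (√2 / 2 : ℝ) * (1 - Complex.I) := by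
      rw [Complex.cpow_def_of_ne_zero (by simp), Complex.log_neg_I,
        show -(π / 2 : ℂ) * Complex.I * (1 / 2) = ((-(π / 4) : ℝ) : ℂ) * Complex.I by push_cast; ring,
        Complex.exp_mul_I, ← Complex.ofReal_cos, ← Complex.ofReal_sin, Real.cos_neg, Real.sin_neg,
        Real.cos_pi_div_four, Real.sin_pi_div_four]
      push_cast
      ring
    have h3 : √(2 / c) * (√2 / 2) = 1 / √c := by
      rw [Real.sqrt_div zero_le_two]
      have := Real.mul_self_sqrt (zero_le_two (α := ℝ))
      linear_combination (1 / (2 * √c)) * this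
    rw [mul_comm (-Complex.I), div_eq_mul_one_div _ (√c : ℂ), mul_comm (1 - Complex.I)]
    push_cast at h1
    rw [h1, h2, ← mul_assoc, ← Complex.ofReal_mul, h3]
    push_cast
    rfl
  have h1I : (1 - Complex.I) ≠ 0 := by
    intro h
    simpa using congrArg Complex.re h
  have hsc : (√c : ℂ) ≠ 0 := by exact_mod_cast (Real.sqrt_pos.2 hcr).ne'
  have lim5 := ((((continuousAt_cpow_const (b := 1 / 2) ?_).tendsto.comp lim3).div
    ((continuousAt_cpow_const (b := 1 / 2) ?_).tendsto.comp lim4)) ?_).mul lim2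
  · have h6 := tendsto_nhds_unique (lim1.congr' ?_) lim5
    · rw [value3, value4] at h6
      have hs2 : (√c : ℂ) ^ 2 = c := by exact_mod_cast Real.sq_sqrt hcr.le
      have h7 : (1 + Complex.I) * (1 - Complex.I) = 2 := by linear_combination -hI
      push_cast at h6
      field_simp at h6
      refine mul_right_cancel₀ h1I ?_
      rw [h6]
      linear_combination (-(√c : ℂ) * (1 + (-Complex.I) ^ c) / 2) * h7
    · filter_upwards [eventually_gt_atTop 0] with t ht
      have ht0 : (t : ℂ) ≠ 0 := by exact_mod_cast ht.ne'
      have hwt : w t ≠ 0 := by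
        intro h
        have := hwre t
        rw [h, Complex.zero_re] at this
        have : 0 < 4 * t / (c : ℝ) ^ 2 := by positivity
        linarith
      have hτ0 : (2 / c + Complex.I / t : ℂ) ≠ 0 := by
        intro h
        have := congrArg Complex.re h
        rw [show (2 / c + Complex.I / t : ℂ) = ((2 / c : ℝ) : ℂ) + ((1 / t : ℝ) : ℂ) * Complex.I by
          push_cast; ring] at this
        simp [hcr.ne'] at this
      have hS1 : ∑' n : ℤ, Complex.exp ((2 * π * (n : ℝ) ^ 2 / c : ℝ) * Complex.I) *
          Complex.exp (-π * n ^ 2 / t) = jacobiTheta₂ 0 (2 / c + Complex.I / t) := by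
        refine tsum_congr fun n => ?_
        rw [jacobiTheta₂_term, ← Complex.exp_add]
        congr 1
        push_cast
        linear_combination (-(π : ℂ) * n ^ 2 / t) * hI
      have hS2 : ∑' n : ℤ, Complex.exp ((-π * c * (n : ℝ) ^ 2 / 2 : ℝ) * Complex.I) *
          Complex.exp (-π * n ^ 2 / w t) = jacobiTheta₂ 0 (-1 / (2 / c + Complex.I / t)) := by
        have e : -1 / (2 / c + Complex.I / t) = -c / 2 + Complex.I / w t := by
          rw [div_eq_iff hτ0]
          have : w t = (2 * t / c) * (2 / c + Complex.I / t) := by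
            simp only [hw]
            field_simp
            ring
          have hcancel : ∀ τ : ℂ, τ ≠ 0 →
              Complex.I / (2 * t / c * τ) * τ = Complex.I * c / (2 * t) := by
            intro τ hτ
            field_simp
          rw [this, add_mul, hcancel _ hτ0]
          field_simp
          ring
        rw [e]
        refine tsum_congr fun n => ?_
        rw [jacobiTheta₂_term, ← Complex.exp_add]
        congr 1
        push_cast
        linear_combination (-(π : ℂ) * n ^ 2 / w t) * hI
      have hwt2 : (w t) ^ (1 / 2 : ℂ) = (t : ℂ) ^ (1 / 2 : ℂ) * (w t / t) ^ (1 / 2 : ℂ) := by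
        have h8 := cpow_half_pos_mul ht (w t / t)
        have h9 := cpow_half_pos_mul ht 1
        rw [mul_div_cancel₀ _ ht0] at h8
        rw [Complex.one_cpow, mul_one, mul_one] at h9
        rw [h8, h9]
      have hq : (w t / t) ^ (1 / 2 : ℂ) ≠ 0 := by
        rw [Complex.cpow_ne_zero_iff]; exact Or.inl (div_ne_zero hwt ht0)
      rw [hS1, jacobiTheta₂_functional_equation, Pi.div_apply, hS2, hwt2]
      simp only [Function.comp_apply, zero_div, ne_eq, OfNat.ofNat_ne_zero, not_false_eq_true, zero_pow,
        mul_zero, Complex.exp_zero]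
      field_simp
  · left
    rw [show (4 / (c : ℂ) ^ 2) = ((4 / c ^ 2 : ℝ) : ℂ) by push_cast; rfl, Complex.ofReal_re]
    positivity
  · right
    rw [show (-Complex.I * (2 / (c : ℂ))) = ((-(2 / c) : ℝ) : ℂ) * Complex.I by push_cast; ring]
    simp [hcr.ne']
  · rw [value4]
    exact div_ne_zero h1I hsc

lemma neg_I_pow_mod (c : ℕ) : (-Complex.I) ^ c = (-Complex.I) ^ (c % 4) := by
  have h4 : (-Complex.I) ^ 4 = 1 := by
    rw [neg_pow, Complex.I_pow_four]; norm_num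
  conv_lhs => rw [← Nat.div_add_mod c 4, pow_add, pow_mul, h4, one_pow, one_mul]

lemma gaussSumG_eq_zero (a : ℤ) (c : ℕ) (ha : Odd a) (hc : c % 4 = 2) : gaussSumG a 0 c = 0 := by
  obtain ⟨m, rfl⟩ : ∃ m, c = m * 2 := ⟨c / 2, by omega⟩
  have hm : Odd m := Nat.odd_iff.2 (by omega)
  have : NeZero m := ⟨by omega⟩
  rw [gaussSumG_zero_eq_sum_range, sum_range_mul_eq]
  refine sum_eq_zero fun u _ => ?_
  have hneg : stdAddChar (((m * (a * m) : ℤ)) : ZMod (m * 2)) = (-1 : ℂ) := by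
    have h1 : ((a * m : ℤ) : ZMod 2) = ((1 : ℤ) : ZMod 2) := by
      rw [ZMod.intCast_eq_intCast_iff]
      exact Int.odd_iff.1 (ha.mul (by exact_mod_cast hm))
    rw [stdAddChar_mul_left m 2, h1, ZMod.stdAddChar_coe, ← Complex.exp_pi_mul_I]
    congr 1
    push_cast
    ring
  have hshift : ((a * ((u + m * 1 : ℕ) : ℤ) ^ 2 : ℤ) : ZMod (m * 2)) =
      ((a * (u : ℤ) ^ 2 : ℤ) : ZMod (m * 2)) + ((m * (a * m) : ℤ) : ZMod (m * 2)) := by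
    have h0 : (m : ZMod (m * 2)) * (2 : ℕ) = 0 := by rw [← Nat.cast_mul, ZMod.natCast_self]
    push_cast at h0 ⊢
    linear_combination ((a : ZMod (m * 2)) * u) * h0
  rw [sum_range_succ, sum_range_one, hshift, AddChar.map_add_eq_mul, hneg]
  simp

lemma gaussSumG_natCast_of_four_dvd (n c : ℕ) [NeZero c] (h : n.Coprime c) (hc : c % 4 = 0) :
    gaussSumG n 0 c = (jacobiSym c n : ℂ) * (1 + Complex.I ^ n) * √c := by
  have hn : Odd n := by
    rw [← Nat.coprime_two_right]
    exact h.coprime_dvd_right (by omega)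
  have : NeZero n := ⟨by rintro rfl; simp at hn⟩
  have hodd := gaussSumG_odd n hn c (by simpa using h.symm)
  have hmul := gaussSumG_mul 1 c n h.symm
  have : NeZero (c * n) := ⟨mul_ne_zero (NeZero.ne c) (NeZero.ne n)⟩
  rw [one_mul, one_mul, hodd, gaussSumG_one_left, gaussSumG_one_left, neg_I_pow_mod (c * n),
    Nat.mul_mod, hc, zero_mul, Nat.zero_mod, pow_zero, hn.neg_pow] at hmul
  have hJ : (jacobiSym c n : ℂ) ^ 2 = 1 := by
    exact_mod_cast jacobiSym.sq_one (by simpa using h.symm)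
  have hI2 : (Complex.I ^ n) ^ 2 = -1 := by
    rw [← pow_mul, mul_comm, pow_mul, Complex.I_sq, hn.neg_one_pow]
  have hsn : (√n : ℂ) ≠ 0 := by
    exact_mod_cast (Real.sqrt_pos.2 (Nat.cast_pos.2 (NeZero.pos n))).ne'
  have h1I : (1 + Complex.I) ≠ 0 := by
    intro h
    simpa using congrArg Complex.re h
  rw [Nat.cast_mul, Real.sqrt_mul (Nat.cast_nonneg c)] at hmul
  push_cast at hmul
  refine mul_right_cancel₀ (mul_ne_zero hsn h1I) ?_
  linear_combination (-(jacobiSym c n : ℂ) * (1 + Complex.I ^ n)) * hmul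
    - (gaussSumG n 0 c * √n * (1 + Complex.I)) * hJ
    + ((jacobiSym c n : ℂ) ^ 2 * gaussSumG n 0 c * √n * (1 + Complex.I) / 2) * hI2

open ComplexConjugate in
lemma gaussSumG_neg_left (a : ℤ) (c : ℕ) : gaussSumG (-a) 0 c = conj (gaussSumG a 0 c) := by
  rw [gaussSumG, gaussSumG, map_sum]
  refine sum_congr rfl fun l _ => ?_
  rw [← Complex.exp_conj]
  congr 1
  have h2 : conj (2 : ℂ) = 2 := map_ofNat _ 2
  simp [h2]

theorem statement0 (a b : ℤ) (c : ℕ) (hc : 0 < c) (h : Int.gcd a c = 1) :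
    (c % 4 = 0 → gaussSumG a 0 c
      = (jacobiSym (c : ℤ) a.natAbs : ℂ) * (1 + Complex.I ^ a) * Real.sqrt c) ∧
    (c % 4 = 1 → gaussSumG a 0 c = (jacobiSym a c : ℂ) * Real.sqrt c) ∧
    (c % 4 = 2 → gaussSumG a 0 c = 0) ∧
    (c % 4 = 3 → gaussSumG a 0 c = (jacobiSym a c : ℂ) * Complex.I * Real.sqrt c) := by
  have : NeZero c := ⟨hc.ne'⟩
  have hI := Complex.I_sq
  refine ⟨fun h0 => ?_, fun h1 => ?_, fun h2 => ?_, fun h3 => ?_⟩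
  · have hcop : a.natAbs.Coprime c := by simpa [Int.gcd] using h
    have key := gaussSumG_natCast_of_four_dvd a.natAbs c hcop h0
    rcases Int.natAbs_eq a with ha | ha
    · rw [← ha] at key
      rw [key]
      congr 3
      conv_rhs => rw [ha, zpow_natCast]
    · rw [show gaussSumG a 0 c = gaussSumG (-(a.natAbs : ℤ)) 0 c by rw [← ha],
        gaussSumG_neg_left, key]
      have hpow : Complex.I ^ a = (-Complex.I) ^ a.natAbs := by
        conv_lhs => rw [ha, zpow_neg, ← inv_zpow, zpow_natCast, Complex.inv_I]
      rw [hpow]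
      simp
  · rw [gaussSumG_odd c (Nat.odd_iff.2 (by omega)) a h, gaussSumG_one_left, neg_I_pow_mod, h1]
    linear_combination (-(jacobiSym a c : ℂ) * √c / 2) * hI
  · refine gaussSumG_eq_zero a c ?_ h2
    rw [← Int.not_even_iff_odd]
    intro he
    have : (2 : ℤ) ∣ Int.gcd a c := Int.dvd_coe_gcd he.two_dvd (by omega)
    rw [h] at this
    norm_num at this
  · rw [gaussSumG_odd c (Nat.odd_iff.2 (by omega)) a h, gaussSumG_one_left, neg_I_pow_mod, h3]
    linear_combination ((jacobiSym a c : ℂ) * √c / 2 * (1 - Complex.I - Complex.I ^ 2)) * hI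
end

section
/- Let a, b be integers and c, d positive integers with gcd(c, d) = 1. Then the generalized quadratic Gauß sums are multiplicative in the modulus: G(a, b, cd) = G(ac, b, d) · G(ad, b, c). -/
open Finset Real

/-- By the Chinese remainder theorem, `(m, n) ↦ c m + d n` is injective modulo `c d` on
`{0, …, d - 1} × {0, …, c - 1}`. -/
theorem injOn_mul_add_mul_mod {c d : ℕ} (h : Nat.Coprime c d) :
    Set.InjOn (fun p : ℕ × ℕ ↦ (c * p.1 + d * p.2) % (c * d))
      (range d ×ˢ range c : Finset (ℕ × ℕ)) := by
  rintro ⟨m, n⟩ hp ⟨m', n'⟩ hp' heq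
  simp only [coe_product, coe_range, Set.mem_prod, Set.mem_Iio] at hp hp'
  have hmod : c * m + d * n ≡ c * m' + d * n' [MOD c * d] := heq
  have hm : c * m ≡ c * m' [MOD d] := by
    simpa [Nat.ModEq] using hmod.of_mul_left c
  have hn : d * n ≡ d * n' [MOD c] := by
    simpa [Nat.ModEq] using hmod.of_mul_right d
  exact Prod.ext
    ((hm.cancel_left_of_coprime h.symm).eq_of_lt_of_lt hp.1 hp'.1)
    ((hn.cancel_left_of_coprime h).eq_of_lt_of_lt hp.2 hp'.2)

/-- The summand of `gaussSumG a b c` is periodic modulo `c`. -/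
theorem exp_quadratic_mod (a b : ℤ) {c : ℕ} (hc : 0 < c) (k : ℕ) :
    Complex.exp (2 * Real.pi * Complex.I *
      ((a : ℂ) * (k % c : ℕ) ^ 2 + (b : ℂ) * (k % c : ℕ)) / c) =
    Complex.exp (2 * Real.pi * Complex.I * ((a : ℂ) * k ^ 2 + (b : ℂ) * k) / c) := by
  have hc' : (c : ℂ) ≠ 0 := Nat.cast_ne_zero.mpr hc.ne'
  have hk : (k : ℂ) = (k % c : ℕ) + c * (k / c : ℕ) := by
    exact_mod_cast (Nat.mod_add_div k c).symm
  rw [Complex.exp_eq_exp_iff_exists_int]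
  refine ⟨-(a * (2 * (k % c : ℕ) * (k / c : ℕ) + c * (k / c : ℕ) ^ 2) + b * (k / c : ℕ)), ?_⟩
  rw [hk]
  generalize k % c = r
  generalize k / c = q
  push_cast
  field_simp
  ring

theorem statement1 (a b : ℤ) (c d : ℕ) (hc : 0 < c) (hd : 0 < d) (h : Nat.Coprime c d) :
    gaussSumG a b (c * d) = gaussSumG (a * c) b d * gaussSumG (a * d) b c := by
  have hcd : 0 < c * d := Nat.mul_pos hc hd
  have hmaps : Set.MapsTo (fun p : ℕ × ℕ ↦ (c * p.1 + d * p.2) % (c * d))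
      (range d ×ˢ range c : Finset (ℕ × ℕ)) (range (c * d)) :=
    fun p _ ↦ mem_coe.mpr (mem_range.mpr (Nat.mod_lt _ hcd))
  have hinj := injOn_mul_add_mul_mod h
  have hsurj := surjOn_of_injOn_of_card_le _ hmaps hinj (by simp [mul_comm])
  unfold gaussSumG
  rw [sum_mul_sum, ← sum_product']
  symm
  refine sum_nbij _ hmaps hinj hsurj ?_
  rintro ⟨m, n⟩ -
  have hc' : (c : ℂ) ≠ 0 := Nat.cast_ne_zero.mpr hc.ne'
  have hd' : (d : ℂ) ≠ 0 := Nat.cast_ne_zero.mpr hd.ne'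
  rw [exp_quadratic_mod a b hcd, ← Complex.exp_add, Complex.exp_eq_exp_iff_exists_int]
  refine ⟨-(2 * a * m * n), ?_⟩
  push_cast
  field_simp
  ring
end

section
/- Let c = 2^r with r ≥ 2, let a be an odd integer, let b be an even integer, and let φ be an integer satisfying aφ ≡ 1 (mod c). Then G(a, b, c) = exp(−πi φ b²/(2c)) · (c|a) · (1 + i^a) · √c, where (c|a) is the Jacobi symbol. -/
open Finset Real

/-- The root of unity `exp(2πi n/c)`. -/
noncomputable def expDiv (c : ℕ) (n : ℤ) : ℂ :=
  Complex.exp (2 * Real.pi * Complex.I * n / c)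

theorem expDiv_add (c : ℕ) (m n : ℤ) : expDiv c (m + n) = expDiv c m * expDiv c n := by
  rw [expDiv, expDiv, expDiv, ← Complex.exp_add]
  congr 1
  push_cast
  ring

theorem expDiv_zero (c : ℕ) : expDiv c 0 = 1 := by simp [expDiv]

theorem expDiv_mul_mul {d : ℕ} (hd : d ≠ 0) (c : ℕ) (n : ℤ) :
    expDiv (d * c) (d * n) = expDiv c n := by
  have : (d : ℂ) ≠ 0 := by exact_mod_cast hd
  rw [expDiv, expDiv]
  congr 1
  push_cast
  rw [mul_left_comm, mul_div_mul_left _ _ this]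

theorem expDiv_self_mul {c : ℕ} (hc : c ≠ 0) (k : ℤ) : expDiv c (c * k) = 1 := by
  have h : (c : ℂ) ≠ 0 := by exact_mod_cast hc
  rw [expDiv, Complex.exp_eq_one_iff]
  refine ⟨k, ?_⟩
  push_cast
  field_simp

theorem expDiv_congr {c : ℕ} (hc : c ≠ 0) {m n : ℤ} (h : m ≡ n [ZMOD c]) :
    expDiv c m = expDiv c n := by
  obtain ⟨k, hk⟩ := h.symm.dvd
  rw [show m = n + c * k by linarith, expDiv_add, expDiv_self_mul hc, mul_one]

theorem expDiv_two_one : expDiv 2 1 = -1 := by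
  rw [← Complex.exp_pi_mul_I, expDiv]
  congr 1
  push_cast
  ring

theorem expDiv_four_one : expDiv 4 1 = Complex.I := by
  rw [← Complex.exp_pi_div_two_mul_I, expDiv]
  congr 1
  push_cast
  ring

theorem expDiv_eight_one : expDiv 8 1 = (√2 / 2 : ℝ) * (1 + Complex.I) := by
  have : expDiv 8 1 = Complex.exp ((π / 4 : ℝ) * Complex.I) := by
    rw [expDiv]
    congr 1
    push_cast
    ring
  rw [this, Complex.exp_mul_I, ← Complex.ofReal_cos, ← Complex.ofReal_sin, Real.cos_pi_div_four,
    Real.sin_pi_div_four]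
  ring

theorem sum_range_add_int_of_periodic {f : ℤ → ℂ} {c : ℕ} (hf : ∀ n, f (n + c) = f n) (k : ℤ) :
    ∑ l ∈ range c, f (l + k) = ∑ l ∈ range c, f l := by
  have step (k : ℤ) : ∑ l ∈ range c, f (l + (k + 1)) = ∑ l ∈ range c, f (l + k) := by
    have h := sum_range_succ (fun l : ℕ => f (l + k)) c
    rw [sum_range_succ', add_comm (c : ℤ) k, hf] at h
    simp only [Nat.cast_zero, zero_add, add_left_inj] at h
    rw [← h]
    refine sum_congr rfl fun l _ => ?_
    push_cast
    ring_nf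
  induction k using Int.induction_on with
  | zero => simp
  | succ n ih => rw [step, ih]
  | pred n ih => rw [← ih, ← step, sub_add_cancel]

theorem gaussSumG_eq_sum_expDiv (a b : ℤ) (c : ℕ) :
    gaussSumG a b c = ∑ l ∈ range c, expDiv c (a * l ^ 2 + b * l) := by
  simp [gaussSumG, expDiv]

/-- Completing the square. -/
theorem gaussSumG_two_mul {a φ : ℤ} {c : ℕ} (hc : c ≠ 0) (hφ : a * φ ≡ 1 [ZMOD c]) (b : ℤ) :
    gaussSumG a (2 * b) c = expDiv c (-(φ * b ^ 2)) * gaussSumG a 0 c := by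
  have key (l : ℤ) : expDiv c (a * l ^ 2 + 2 * b * l) =
      expDiv c (-(φ * b ^ 2)) * expDiv c (a * (l + φ * b) ^ 2) := by
    rw [← expDiv_add]
    refine expDiv_congr hc ?_
    obtain ⟨k, hk⟩ := hφ.dvd
    refine (Int.modEq_iff_dvd).2 ⟨-k * (2 * b * l + φ * b ^ 2), ?_⟩
    linear_combination (-(2 * b * l + φ * b ^ 2)) * hk
  have shift := sum_range_add_int_of_periodic (f := fun n => expDiv c (a * n ^ 2)) (c := c)
    (fun n => expDiv_congr hc ((Int.modEq_iff_dvd).2 ⟨-(a * (2 * n + c)), by ring⟩)) (φ * b)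
  simp only [gaussSumG_eq_sum_expDiv, zero_mul, add_zero, key, ← mul_sum, shift]

theorem sum_range_two_mul (f : ℕ → ℂ) (n : ℕ) :
    ∑ l ∈ range (2 * n), f l = ∑ m ∈ range n, f (2 * m) + ∑ m ∈ range n, f (2 * m + 1) := by
  induction n with
  | zero => simp
  | succ n ih =>
    rw [mul_add, mul_one, sum_range_succ, sum_range_succ, ih, sum_range_succ, sum_range_succ]
    ring

theorem gaussSumG_zero_four_mul {a : ℤ} (ha : Odd a) {d : ℕ} (hd : d ≠ 0) :
    gaussSumG a 0 (4 * (4 * d)) = 2 * gaussSumG a 0 (4 * d) := by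
  have hc : 4 * d ≠ 0 := by positivity
  have even (m : ℕ) : expDiv (4 * (4 * d)) (a * ((2 * m : ℕ) : ℤ) ^ 2) =
      expDiv (4 * d) (a * (m : ℤ) ^ 2) := by
    rw [← expDiv_mul_mul four_ne_zero (4 * d)]
    push_cast
    ring_nf
  have odd (m : ℕ) : expDiv (4 * (4 * d)) (a * ((2 * m + 1 : ℕ) : ℤ) ^ 2) =
      expDiv (4 * (4 * d)) a * expDiv (4 * d) (a * ((m : ℤ) ^ 2 + m)) := by
    rw [← expDiv_mul_mul four_ne_zero (4 * d), ← expDiv_add]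
    push_cast
    ring_nf
  have double (f : ℕ → ℂ) (n : ℕ) :
      ∑ l ∈ range (2 * n), f l = ∑ l ∈ range n, f l + ∑ l ∈ range n, f (n + l) := by
    rw [two_mul, sum_range_add]
  have periodic (m : ℕ) : expDiv (4 * d) (a * ((4 * d + m : ℕ) : ℤ) ^ 2) =
      expDiv (4 * d) (a * (m : ℤ) ^ 2) :=
    expDiv_congr hc ((Int.modEq_iff_dvd).2 ⟨-(a * (2 * m + 4 * d)), by push_cast; ring⟩)
  have half : expDiv (4 * d) (2 * d) = -1 := by
    rw [← expDiv_two_one, ← expDiv_mul_mul (d := 2 * d) (by positivity) 2 1]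
    push_cast
    ring_nf
  have antiperiodic (m : ℤ) : expDiv (4 * d) (a * ((m + 2 * d) ^ 2 + (m + 2 * d))) =
      -expDiv (4 * d) (a * (m ^ 2 + m)) := by
    obtain ⟨k, rfl⟩ := ha
    rw [← mul_neg_one, ← half, ← expDiv_add]
    refine expDiv_congr hc ((Int.modEq_iff_dvd).2 ⟨-((2 * k + 1) * (m + d) + k), ?_⟩)
    push_cast
    ring
  have odd_sum : ∑ m ∈ range (2 * (4 * d)), expDiv (4 * d) (a * ((m : ℤ) ^ 2 + m)) = 0 := by
    have h := sum_range_add_int_of_periodic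
      (f := fun n => expDiv (4 * d) (a * (n ^ 2 + n))) (c := 2 * (4 * d))
      (fun n => expDiv_congr hc ((Int.modEq_iff_dvd).2
        ⟨-(2 * a * (2 * n + 8 * d + 1)), by push_cast; ring⟩)) (2 * d)
    simp only [antiperiodic, sum_neg_distrib] at h
    exact self_eq_neg.1 h.symm
  simp only [gaussSumG_eq_sum_expDiv, zero_mul, add_zero]
  rw [show 4 * (4 * d) = 2 * (2 * (4 * d)) by ring, sum_range_two_mul,
    show 2 * (2 * (4 * d)) = 4 * (4 * d) by ring]
  simp only [even, odd, ← mul_sum, odd_sum]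
  rw [double]
  simp only [periodic]
  ring

theorem I_zpow_eq_of_emod {a : ℤ} {s : ℕ} (h : a % 4 = s) : Complex.I ^ a = Complex.I ^ s := by
  rw [← Int.emod_add_mul_ediv a 4, h, zpow_add₀ Complex.I_ne_zero, zpow_mul]
  have : Complex.I ^ (4 : ℤ) = 1 := by exact_mod_cast Complex.I_pow_four
  simp [this]

theorem gaussSumG_zero_four {a : ℤ} (ha : Odd a) : gaussSumG a 0 4 = 2 * (1 + Complex.I ^ a) := by
  have red (n : ℤ) : expDiv 4 n = expDiv 4 (n % 4) :=
    expDiv_congr (by norm_num) (Int.mod_modEq n 4).symm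
  have h2 : expDiv 4 2 = -1 := by
    rw [show (2 : ℤ) = 1 + 1 by norm_num, expDiv_add, expDiv_four_one, Complex.I_mul_I]
  have h3 : expDiv 4 3 = -Complex.I := by
    rw [show (3 : ℤ) = 2 + 1 by norm_num, expDiv_add, h2, expDiv_four_one, neg_one_mul]
  have hmod : a % 4 = 1 ∨ a % 4 = 3 := by have := Int.odd_iff.1 ha; omega
  simp only [gaussSumG_eq_sum_expDiv, zero_mul, add_zero, sum_range_succ, range_zero, sum_empty]
  rcases hmod with h | h
  · rw [I_zpow_eq_of_emod (s := 1) h, red (a * (0 : ℕ) ^ 2), red (a * (1 : ℕ) ^ 2),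
      red (a * (2 : ℕ) ^ 2), red (a * (3 : ℕ) ^ 2)]
    simp [Int.mul_emod, h, expDiv_zero, expDiv_four_one]
    ring
  · rw [I_zpow_eq_of_emod (s := 3) h, red (a * (0 : ℕ) ^ 2), red (a * (1 : ℕ) ^ 2),
      red (a * (2 : ℕ) ^ 2), red (a * (3 : ℕ) ^ 2)]
    simp [Int.mul_emod, h, expDiv_zero, h3]
    ring

theorem jacobiSym_two_natAbs {a : ℤ} (ha : Odd a) :
    jacobiSym 2 a.natAbs = if a % 8 = 1 ∨ a % 8 = 7 then 1 else -1 := by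
  have h1 := Int.odd_iff.1 ha
  rw [jacobiSym.at_two (Int.natAbs_odd.2 ha), ZMod.χ₈_nat_eq_if_mod_eight]
  split_ifs <;> omega

theorem gaussSumG_zero_eight {a : ℤ} (ha : Odd a) :
    gaussSumG a 0 8 = jacobiSym 2 a.natAbs * (1 + Complex.I ^ a) * (2 * √2 : ℝ) := by
  have h2 : expDiv 8 2 = Complex.I := by
    rw [← expDiv_four_one, ← expDiv_mul_mul two_ne_zero 4 1]
    norm_num
  have h4 : expDiv 8 4 = -1 := by
    rw [show (4 : ℤ) = 2 + 2 by norm_num, expDiv_add, h2, Complex.I_mul_I]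
  have hodd : gaussSumG a 0 8 = 4 * expDiv 8 a := by
    have hred (m n : ℤ) (h : m ≡ n [ZMOD 8]) : expDiv 8 (a * m) = expDiv 8 (a * n) :=
      expDiv_congr (by norm_num) (h.mul_left a)
    have hfour : expDiv 8 (a * 4) = -1 := by
      obtain ⟨k, rfl⟩ := ha
      rw [← h4]
      exact expDiv_congr (by norm_num) ((Int.modEq_iff_dvd).2 ⟨-k, by push_cast; ring⟩)
    simp only [gaussSumG_eq_sum_expDiv, zero_mul, add_zero, sum_range_succ, range_zero, sum_empty]
    norm_num only
    rw [hred 9 1 (by decide), hred 16 0 (by decide), hred 25 1 (by decide), hred 36 4 (by decide),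
      hred 49 1 (by decide), hfour, mul_zero, mul_one, expDiv_zero]
    ring
  have h3 : expDiv 8 3 = Complex.I * expDiv 8 1 := by rw [← h2, ← expDiv_add]; norm_num
  have h5 : expDiv 8 5 = -expDiv 8 1 := by
    rw [show (5 : ℤ) = 4 + 1 by norm_num, expDiv_add, h4, neg_one_mul]
  have h7 : expDiv 8 7 = -(Complex.I * expDiv 8 1) := by
    rw [← h3, show (7 : ℤ) = 4 + 3 by norm_num, expDiv_add, h4, neg_one_mul]
  have hred : expDiv 8 a = expDiv 8 (a % 8) :=
    expDiv_congr (by norm_num) (Int.mod_modEq a 8).symm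
  have hmod : a % 8 = 1 ∨ a % 8 = 3 ∨ a % 8 = 5 ∨ a % 8 = 7 := by
    have := Int.odd_iff.1 ha
    omega
  rw [hodd, hred, jacobiSym_two_natAbs ha]
  have I2 := Complex.I_sq
  rcases hmod with h | h | h | h
  · rw [I_zpow_eq_of_emod (a := a) (s := 1) (by omega), h, expDiv_eight_one]
    push_cast
    norm_num
    ring
  · rw [I_zpow_eq_of_emod (a := a) (s := 3) (by omega), h, h3, expDiv_eight_one]
    push_cast
    norm_num
    linear_combination 2 * (√2 : ℂ) * I2
  · rw [I_zpow_eq_of_emod (a := a) (s := 1) (by omega), h, h5, expDiv_eight_one]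
    push_cast
    norm_num
    ring
  · rw [I_zpow_eq_of_emod (a := a) (s := 3) (by omega), h, h7, expDiv_eight_one]
    push_cast
    norm_num
    linear_combination -2 * (√2 : ℂ) * I2

theorem gaussSumG_zero_two_pow {a : ℤ} (ha : Odd a) (n : ℕ) :
    gaussSumG a 0 (2 ^ (n + 2)) =
      jacobiSym (2 ^ (n + 2)) a.natAbs * (1 + Complex.I ^ a) * √(2 ^ (n + 2)) := by
  have hsq : jacobiSym 2 a.natAbs ^ 2 = 1 := by
    rw [jacobiSym_two_natAbs ha]
    split_ifs <;> norm_num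
  have hstep (m : ℕ) : √(2 ^ (m + 2) : ℝ) = √(2 ^ m) * 2 := by
    rw [pow_add, Real.sqrt_mul (by positivity), Real.sqrt_sq zero_le_two]
  induction n using Nat.twoStepInduction with
  | zero =>
    rw [jacobiSym.pow_left, zero_add, hsq, Real.sqrt_sq zero_le_two]
    norm_num [gaussSumG_zero_four ha]
    ring
  | one =>
    rw [jacobiSym.pow_left, show 1 + 2 = 2 + 1 from rfl, pow_succ (jacobiSym _ _), hsq, one_mul,
      show 2 + 1 = 1 + 2 from rfl, hstep, pow_one, mul_comm (√2)]
    exact gaussSumG_zero_eight ha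
  | more n ih _ =>
    rw [show 2 ^ (n + 2 + 2) = 4 * (4 * 2 ^ n) by ring,
      gaussSumG_zero_four_mul ha (by positivity), show 4 * 2 ^ n = 2 ^ (n + 2) by ring, ih,
      hstep (n + 2), jacobiSym.pow_left, jacobiSym.pow_left, pow_add _ (n + 2) 2, hsq]
    push_cast
    ring

theorem statement6 (r : ℕ) (hr : 2 ≤ r) (a b φ : ℤ) (ha : Odd a) (hb : Even b)
    (hφ : a * φ ≡ 1 [ZMOD ((2 : ℤ) ^ r)]) :
    gaussSumG a b (2 ^ r)
      = Complex.exp (-(Real.pi * Complex.I * (φ : ℂ) * (b : ℂ) ^ 2 / (2 * (2 : ℂ) ^ r)))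
        * (jacobiSym ((2 : ℤ) ^ r) a.natAbs : ℂ) * (1 + Complex.I ^ a)
        * Real.sqrt (2 ^ r) := by
  obtain ⟨n, rfl⟩ := Nat.exists_eq_add_of_le' hr
  obtain ⟨β, rfl⟩ := hb.exists_two_nsmul
  have hexp : Complex.exp (-(π * Complex.I * (φ : ℂ) * ((2 • β : ℤ) : ℂ) ^ 2
      / (2 * (2 : ℂ) ^ (n + 2)))) = expDiv (2 ^ (n + 2)) (-(φ * β ^ 2)) := by
    rw [expDiv]
    congr 1
    push_cast [nsmul_eq_mul]
    field_simp
  rw [hexp, nsmul_eq_mul, Nat.cast_ofNat,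
    gaussSumG_two_mul (by positivity) (by exact_mod_cast hφ), gaussSumG_zero_two_pow ha]
  ring
end

section
/- Let a, b be integers and c a positive integer with c ≡ 2 (mod 4) and gcd(a, c) = 1 (so a is odd and c/2 is odd). Then G(a, b, c) = G(a·(c/2), b, 2) · G(2a, b, c/2); in particular, G(a, b, c) = 0 if b is even, and G(a, b, c) = 2 · G(2a, b, c/2) if b is odd. -/
open Finset Real

theorem Function.Periodic.sum_range_add {M : Type*} [AddCommMonoid M] {g : ℕ → M} {m : ℕ}
    (hg : Function.Periodic g m) (k : ℕ) :
    ∑ y ∈ Finset.range m, g (y + k) = ∑ y ∈ Finset.range m, g y := by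
  induction k with
  | zero => rfl
  | succ k ih =>
    cases m with
    | zero => rfl
    | succ m =>
      rw [← ih, Finset.sum_range_succ, Finset.sum_range_succ' (fun y => g (y + k))]
      congr 1
      · exact Finset.sum_congr rfl fun y _ => by congr 1; ring
      · rw [← hg (0 + k)]
        congr 1
        ring

theorem Finset.sum_range_two_mul_eq {M : Type*} [AddCommMonoid M] (f : ℕ → M) (m : ℕ) :
    ∑ l ∈ Finset.range (2 * m), f l =
      ∑ y ∈ Finset.range m, f (2 * y) + ∑ y ∈ Finset.range m, f (2 * y + 1) := by
  induction m with
  | zero => simp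
  | succ m ih =>
    rw [mul_add, mul_one, Finset.sum_range_succ, Finset.sum_range_succ, ih,
      Finset.sum_range_succ, Finset.sum_range_succ]
    abel

theorem Function.Periodic.sum_range_two_mul_of_odd {M : Type*} [AddCommMonoid M] {f : ℕ → M}
    {m : ℕ} (hf : Function.Periodic f (2 * m)) (hm : Odd m) :
    ∑ l ∈ Finset.range (2 * m), f l =
      ∑ y ∈ Finset.range m, f (2 * y) + ∑ y ∈ Finset.range m, f (2 * y + m) := by
  obtain ⟨k, hk⟩ := hm
  have hg : Function.Periodic (fun y => f (2 * y + 1)) m := fun y => by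
    change f (2 * (y + m) + 1) = f (2 * y + 1)
    rw [← hf (2 * y + 1)]
    congr 1
    ring
  rw [Finset.sum_range_two_mul_eq, ← hg.sum_range_add k]
  congr 1
  refine Finset.sum_congr rfl fun y _ => ?_
  congr 1
  lia

theorem gaussSumG_two_mul_s7 (a b : ℤ) {m : ℕ} (hm : Odd m) :
    gaussSumG a b (2 * m) = gaussSumG (a * m) b 2 * gaussSumG (2 * a) b m := by
  have hm0 : (m : ℂ) ≠ 0 := Nat.cast_ne_zero.mpr hm.pos.ne'
  unfold gaussSumG
  rw [Function.Periodic.sum_range_two_mul_of_odd _ hm, Finset.sum_range_succ,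
    Finset.sum_range_one, add_mul, Finset.mul_sum, Finset.mul_sum]
  · congr 1
    · refine Finset.sum_congr rfl fun y _ => ?_
      rw [← Complex.exp_add]
      congr 1
      push_cast
      field_simp
      ring
    · refine Finset.sum_congr rfl fun y _ => ?_
      rw [← Complex.exp_add, Complex.exp_eq_exp_iff_exists_int]
      refine ⟨2 * a * y, ?_⟩
      push_cast
      field_simp
      ring
  · intro l
    rw [Complex.exp_eq_exp_iff_exists_int]
    refine ⟨2 * a * l + 2 * a * m + b, ?_⟩
    push_cast
    field_simp
    ring

theorem gaussSumG_two (a b : ℤ) : gaussSumG a b 2 = 1 + (-1 : ℂ) ^ (a + b) := by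
  rw [gaussSumG, Finset.sum_range_succ, Finset.sum_range_one, ← Complex.exp_pi_mul_I,
    ← Complex.exp_int_mul]
  congr 1
  · simp
  · congr 1
    push_cast
    ring

theorem statement7 (a b : ℤ) (c : ℕ) (hc : c % 4 = 2) (h : Int.gcd a c = 1) :
    gaussSumG a b c = gaussSumG (a * ((c / 2 : ℕ) : ℤ)) b 2 * gaussSumG (2 * a) b (c / 2) ∧
    (Even b → gaussSumG a b c = 0) ∧
    (Odd b → gaussSumG a b c = 2 * gaussSumG (2 * a) b (c / 2)) := by
  have hm : Odd (c / 2) := Nat.odd_iff.mpr (by lia)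
  have hmul := gaussSumG_two_mul_s7 a b hm
  rw [show 2 * (c / 2) = c by lia] at hmul
  have ha : Odd a := by
    rw [← Int.not_even_iff_odd]
    intro hae
    have h2 : (2 : ℤ) ∣ Int.gcd a c := Int.dvd_coe_gcd hae.two_dvd (by lia)
    rw [h] at h2
    lia
  have ham : Odd (a * ((c / 2 : ℕ) : ℤ)) := ha.mul (mod_cast hm)
  refine ⟨hmul, fun hb => ?_, fun hb => ?_⟩
  · rw [hmul, gaussSumG_two, (ham.add_even hb).neg_one_zpow]
    simp
  · rw [hmul, gaussSumG_two, (ham.add_odd hb).neg_one_zpow]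
    norm_num
end

section
/- Let M be an integer with M ≥ 3. Then the limit as the positive integer q tends to infinity of (M √q/(2π)) · arccos(2·cos(π/M)^{2/q} − 1) equals (M √2/π) · (−log(cos(π/M)))^{1/2}, where cos(π/M)^{2/q} = exp((2/q)·log cos(π/M)) and log is the natural logarithm. -/
open Real Filter

/-- The half-angle formula for `arccos`. -/
theorem arccos_two_mul_sub_one {y : ℝ} (h0 : 0 ≤ y) (h1 : y ≤ 1) :
    Real.arccos (2 * y - 1) = 2 * Real.arcsin (Real.sqrt (1 - y)) := by
  have hs0 : 0 ≤ Real.sqrt (1 - y) := Real.sqrt_nonneg _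
  have hs1 : Real.sqrt (1 - y) ≤ 1 := Real.sqrt_le_one.mpr (by linarith)
  have hsin : Real.sin (Real.arcsin (Real.sqrt (1 - y))) = Real.sqrt (1 - y) :=
    Real.sin_arcsin (by linarith) hs1
  have hcos : Real.cos (2 * Real.arcsin (Real.sqrt (1 - y))) = 2 * y - 1 := by
    rw [Real.cos_two_mul, Real.cos_sq', hsin, Real.sq_sqrt (by linarith)]
    ring
  rw [← hcos]
  refine Real.arccos_cos ?_ ?_
  · linarith [Real.arcsin_nonneg.mpr hs0]
  · linarith [Real.arcsin_le_pi_div_two (Real.sqrt (1 - y))]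

theorem tendsto_mul_one_sub_rpow_div {c : ℝ} (hc : 0 < c) (a : ℝ) :
    Tendsto (fun q : ℕ => (q : ℝ) * (1 - c ^ (a / (q : ℝ)))) atTop
      (nhds (-(a * Real.log c))) := by
  have hd : HasDerivAt (fun x : ℝ => Real.exp (Real.log c * (a * x))) (a * Real.log c) 0 := by
    have h := (((hasDerivAt_id (0 : ℝ)).const_mul a).const_mul (Real.log c)).exp
    simpa [mul_comm] using h
  have hcont := continuousAt_dslope_same.mpr hd.differentiableAt
  have ht := hcont.tendsto.comp (tendsto_inv_atTop_nhds_zero_nat (𝕜 := ℝ))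
  rw [dslope_same, hd.deriv] at ht
  refine ht.neg.congr' ?_
  filter_upwards [eventually_ne_atTop 0] with q hq
  have hq' : (q : ℝ) ≠ 0 := Nat.cast_ne_zero.mpr hq
  rw [Function.comp_apply, dslope_of_ne _ (inv_ne_zero hq'), slope_def_field,
    Real.rpow_def_of_pos hc]
  simp [div_eq_mul_inv]
  ring

theorem tendsto_sqrt_mul_arcsin_sqrt {u : ℕ → ℝ} {l : ℝ}
    (hu : Tendsto (fun q : ℕ => (q : ℝ) * u q) atTop (nhds l)) :
    Tendsto (fun q : ℕ => Real.sqrt q * Real.arcsin (Real.sqrt (u q))) atTop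
      (nhds (Real.sqrt l)) := by
  have hu0 : Tendsto u atTop (nhds 0) := by
    have h := (tendsto_inv_atTop_nhds_zero_nat (𝕜 := ℝ)).mul hu
    rw [zero_mul] at h
    refine h.congr' ?_
    filter_upwards [eventually_ne_atTop 0] with q hq
    exact inv_mul_cancel_left₀ (Nat.cast_ne_zero.mpr hq) _
  have hd : HasDerivAt Real.arcsin 1 0 := by
    simpa using Real.hasDerivAt_arcsin (x := 0) (by norm_num) (by norm_num)
  have hs : Tendsto (fun q => Real.sqrt (u q)) atTop (nhds 0) := by
    simpa using hu0.sqrt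
  have ht := (continuousAt_dslope_same.mpr hd.differentiableAt).tendsto.comp hs
  rw [dslope_same, hd.deriv] at ht
  have h := hu.sqrt.mul ht
  rw [mul_one] at h
  refine h.congr fun q => ?_
  have key := sub_smul_dslope Real.arcsin 0 (Real.sqrt (u q))
  simp only [sub_zero, Real.arcsin_zero, smul_eq_mul] at key
  rw [Function.comp_apply, Real.sqrt_mul (Nat.cast_nonneg q), mul_assoc, key]

/-- As `q → ∞`, `(M√q/(2π)) arccos(2 cos^{2/q}(π/M) − 1)` tends to
`(M√2/π)(−log cos(π/M))^{1/2}`. -/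
theorem statement18 (M : ℤ) (hM : 3 ≤ M) :
    Tendsto (fun q : ℕ =>
        ((M : ℝ) * Real.sqrt q / (2 * π))
          * Real.arccos (2 * Real.cos (π / M) ^ ((2 : ℝ) / q) - 1))
      atTop
      (nhds (((M : ℝ) * Real.sqrt 2 / π) * Real.sqrt (-Real.log (Real.cos (π / M))))) := by
  have hM' : (3 : ℝ) ≤ M := by exact_mod_cast hM
  have hc : 0 < Real.cos (π / M) := by
    refine Real.cos_pos_of_mem_Ioo ⟨?_, ?_⟩
    · have : 0 < π / M := by positivity
      linarith [Real.pi_pos]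
    · exact div_lt_div_of_pos_left Real.pi_pos (by norm_num) (by linarith)
  have h := (tendsto_sqrt_mul_arcsin_sqrt (tendsto_mul_one_sub_rpow_div hc 2)).const_mul
    ((M : ℝ) / π)
  rw [← mul_neg, Real.sqrt_mul zero_le_two, ← mul_assoc, div_mul_eq_mul_div] at h
  refine h.congr fun q => ?_
  rw [arccos_two_mul_sub_one (Real.rpow_nonneg hc.le _)
    (Real.rpow_le_one hc.le (Real.cos_le_one _) (by positivity))]
  field_simp
end
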